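/- Let F=(W,R,P) be a finitely generated descriptive temporal frame. Then: (i) F is a frame for Lin_Q iff F is serial and dense; (ii) F is a frame for Lin_R iff F is serial, dense and Dedekind-complete; (iii) F is a frame for Lin_<ω iff F contains no non-degenerate cluster C with (−∞,C) ∈ P or (C,+∞) ∈ P; (iv) F is a frame for Lin_Z iff F is serial and contains no non-degenerate cluster C with ∅ ≠ (−∞,C) ∈ P or ∅ ≠ (C,+∞) ∈ P. -/

import Mathlib

/-! ## Priorean temporal formulas -/

inductive TMF : Type
  | var : ℕ → TMF
  | top : TMF
  | bot : TMF
  | neg : TMF → TMF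
  | and : TMF → TMF → TMF
  | diaF : TMF → TMF
  | diaP : TMF → TMF
deriving DecidableEq

namespace TMF

def or (φ ψ : TMF) : TMF := .neg (.and (.neg φ) (.neg ψ))
def imp (φ ψ : TMF) : TMF := TMF.or (.neg φ) ψ
def boxF (φ : TMF) : TMF := .neg (.diaF (.neg φ))
def boxP (φ : TMF) : TMF := .neg (.diaP (.neg φ))

def vars : TMF → Finset ℕ
  | .var p => {p}
  | .top => ∅
  | .bot => ∅
  | .neg φ => vars φ
  | .and φ ψ => vars φ ∪ vars ψ
  | .diaF φ => vars φ
  | .diaP φ => vars φ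

def sig (φ : TMF) : Set ℕ := ↑(vars φ)

def subs : TMF → Finset TMF
  | .var p => {.var p}
  | .top => {.top}
  | .bot => {.bot}
  | .neg φ => insert (.neg φ) (subs φ)
  | .and φ ψ => insert (.and φ ψ) (subs φ ∪ subs ψ)
  | .diaF φ => insert (.diaF φ) (subs φ)
  | .diaP φ => insert (.diaP φ) (subs φ)

/-- `|φ|`: the number of subformulas of `φ` together with their negations -/
def size (φ : TMF) : ℕ := ((subs φ) ∪ (subs φ).image TMF.neg).card

end TMF

/-! ## Temporal frames and models -/

/-- a (general) temporal frame -/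
structure TFrame (W : Type) where
  R : W → W → Prop
  P : Set (Set W)

namespace TFrame

variable {W : Type}

def diaF (F : TFrame W) (X : Set W) : Set W := {x | ∃ y ∈ X, F.R x y}
def diaP (F : TFrame W) (X : Set W) : Set W := {x | ∃ y ∈ X, F.R y x}

/-- the conditions making `F` a general temporal frame: the relation is transitive and
connected, and the internal sets are closed under the Booleans, `◇_F` and `◇_P` -/
def IsGeneral (F : TFrame W) : Prop :=
  Nonempty W ∧ Transitive F.R ∧ (∀ x y : W, F.R x y ∨ x = y ∨ F.R y x) ∧
  ∅ ∈ F.P ∧ Set.univ ∈ F.P ∧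
  (∀ X ∈ F.P, ∀ Y ∈ F.P, X ∩ Y ∈ F.P) ∧ (∀ X ∈ F.P, Xᶜ ∈ F.P) ∧
  (∀ X ∈ F.P, F.diaF X ∈ F.P) ∧ (∀ X ∈ F.P, F.diaP X ∈ F.P)

/-- differentiated, tight and compact -/
def Descriptive (F : TFrame W) : Prop :=
  (∀ x y : W, (∀ X ∈ F.P, x ∈ X ↔ y ∈ X) → x = y) ∧
  (∀ x y : W, F.R x y ↔ ∀ X ∈ F.P, y ∈ X → x ∈ F.diaF X) ∧
  (∀ 𝒳 : Set (Set W), 𝒳 ⊆ F.P →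
    (∀ 𝒴 : Set (Set W), 𝒴 ⊆ 𝒳 → 𝒴.Finite → (⋂₀ 𝒴).Nonempty) → (⋂₀ 𝒳).Nonempty)

/-- the strict order on clusters -/
def clLT (F : TFrame W) (x y : W) : Prop := F.R x y ∧ ¬ F.R y x

/-- `F` has non-degenerate `R`-final and `R⁻`-final clusters -/
def Serial (F : TFrame W) : Prop :=
  (∃ x, (∀ y, ¬ F.clLT x y) ∧ F.R x x) ∧ (∃ x, (∀ y, ¬ F.clLT y x) ∧ F.R x x)

/-- between any two distinct degenerate clusters there lies a non-degenerate cluster -/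
def DenseFrm (F : TFrame W) : Prop :=
  ∀ x y, ¬ F.R x x → ¬ F.R y y → F.clLT x y → ∃ z, F.R z z ∧ F.clLT x z ∧ F.clLT z y

/-- between any two distinct non-degenerate clusters there lies a degenerate cluster -/
def DedekindComplete (F : TFrame W) : Prop :=
  ∀ x y, F.R x x → F.R y y → F.clLT x y → ∃ z, ¬ F.R z z ∧ F.clLT x z ∧ F.clLT z y

end TFrame

/-- the closure of a family of sets under `∩`, complement, `◇_F` and `◇_P` -/
inductive tgenBy {W : Type} (R : W → W → Prop) (G : Set (Set W)) : Set W → Prop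
  | basic {X : Set W} : X ∈ G → tgenBy R G X
  | empty : tgenBy R G ∅
  | univ : tgenBy R G Set.univ
  | inter {X Y : Set W} : tgenBy R G X → tgenBy R G Y → tgenBy R G (X ∩ Y)
  | compl {X : Set W} : tgenBy R G X → tgenBy R G Xᶜ
  | diaF {X : Set W} : tgenBy R G X → tgenBy R G {x | ∃ y ∈ X, R x y}
  | diaP {X : Set W} : tgenBy R G X → tgenBy R G {x | ∃ y ∈ X, R y x}

def TFrame.FinGenerated {W : Type} (F : TFrame W) : Prop :=
  ∃ G : Set (Set W), G.Finite ∧ F.P = {X | tgenBy F.R G X}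

/-- a temporal model -/
structure TModel (W : Type) where
  F : TFrame W
  v : ℕ → Set W

namespace TModel

variable {W : Type}

def IsModel (M : TModel W) : Prop := M.F.IsGeneral ∧ ∀ p, M.v p ∈ M.F.P

def sat (M : TModel W) : W → TMF → Prop
  | x, .var p => x ∈ M.v p
  | _, .top => True
  | _, .bot => False
  | x, .neg φ => ¬ sat M x φ
  | x, .and φ ψ => sat M x φ ∧ sat M x ψ
  | x, .diaF φ => ∃ y, M.F.R x y ∧ sat M y φ
  | x, .diaP φ => ∃ y, M.F.R y x ∧ sat M y φ

end TModel

def TFrame.Valid {W : Type} (F : TFrame W) (φ : TMF) : Prop :=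
  ∀ v : ℕ → Set W, (∀ p, v p ∈ F.P) → ∀ x, (TModel.mk F v).sat x φ

def TFrame.IsFrameFor {W : Type} (F : TFrame W) (L : Set TMF) : Prop :=
  ∀ φ ∈ L, F.Valid φ

/-- a temporal Kripke frame -/
def tKripke (W : Type) (R : W → W → Prop) : TFrame W := ⟨R, Set.univ⟩

/-! ## The standard temporal logics -/

/-- the logic of all temporal Kripke frames -/
def Lin : Set TMF :=
  {φ | ∀ (W : Type) (R : W → W → Prop), Nonempty W → Transitive R →
        (∀ x y : W, R x y ∨ x = y ∨ R y x) → (tKripke W R).Valid φ}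

def LinQ : Set TMF := {φ | (tKripke ℚ (· < ·)).Valid φ}
def LinR : Set TMF := {φ | (tKripke ℝ (· < ·)).Valid φ}
def LinZ : Set TMF := {φ | (tKripke ℤ (· < ·)).Valid φ}

/-- the logic of all finite strict linear orders -/
def LinFin : Set TMF :=
  {φ | ∀ (W : Type) (_ : Fintype W) (R : W → W → Prop),
        Nonempty W → IsStrictTotalOrder W R → (tKripke W R).Valid φ}

/-! ## Temporal bisimulations and interpolants -/

def TIsBisim {W₁ W₂ : Type} (σ : Set ℕ) (M₁ : TModel W₁) (M₂ : TModel W₂)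
    (β : W₁ → W₂ → Prop) : Prop :=
  ∀ x₁ x₂, β x₁ x₂ →
    (∀ p ∈ σ, x₁ ∈ M₁.v p ↔ x₂ ∈ M₂.v p) ∧
    (∀ y₁, M₁.F.R x₁ y₁ → ∃ y₂, M₂.F.R x₂ y₂ ∧ β y₁ y₂) ∧
    (∀ y₂, M₂.F.R x₂ y₂ → ∃ y₁, M₁.F.R x₁ y₁ ∧ β y₁ y₂) ∧
    (∀ y₁, M₁.F.R y₁ x₁ → ∃ y₂, M₂.F.R y₂ x₂ ∧ β y₁ y₂) ∧
    (∀ y₂, M₂.F.R y₂ x₂ → ∃ y₁, M₁.F.R y₁ x₁ ∧ β y₁ y₂)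

def TBisimilar {W₁ W₂ : Type} (σ : Set ℕ) (M₁ : TModel W₁) (x₁ : W₁)
    (M₂ : TModel W₂) (x₂ : W₂) : Prop :=
  ∃ β, TIsBisim σ M₁ M₂ β ∧ β x₁ x₂

def TIsInterpolant (L : Set TMF) (φ₁ φ₂ ι : TMF) : Prop :=
  ι.sig ⊆ φ₁.sig ∩ φ₂.sig ∧ TMF.imp φ₁ ι ∈ L ∧ TMF.imp ι φ₂ ∈ L

def TNoInterpolant (L : Set TMF) (φ₁ φ₂ : TMF) : Prop := ¬ ∃ ι, TIsInterpolant L φ₁ φ₂ ι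

/-! ## Internal sets of descriptive frames -/

section InternalSets

variable {W : Type} {F : TFrame W}

/-- The frame with the converse relation. -/
def TFrame.op (F : TFrame W) : TFrame W := ⟨fun x y => F.R y x, F.P⟩

theorem TFrame.IsGeneral.trans (hg : F.IsGeneral) {x y z : W} (h : F.R x y) (h' : F.R y z) :
    F.R x z := hg.2.1 h h'

theorem TFrame.IsGeneral.conn (hg : F.IsGeneral) (x y : W) : F.R x y ∨ x = y ∨ F.R y x :=
  hg.2.2.1 x y

theorem TFrame.IsGeneral.union_mem (hg : F.IsGeneral) {X Y : Set W} (hX : X ∈ F.P)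
    (hY : Y ∈ F.P) : X ∪ Y ∈ F.P := by
  obtain ⟨-, -, -, -, -, hi, hc, -, -⟩ := hg
  have := hc _ (hi _ (hc _ hX) _ (hc _ hY))
  rwa [← Set.compl_union, compl_compl] at this

theorem TFrame.IsGeneral.op (hg : F.IsGeneral) : F.op.IsGeneral := by
  obtain ⟨h1, h2, h3, h4, h5, h6, h7, h8, h9⟩ := hg
  exact ⟨h1, fun x y z h h' => h2 h' h, fun x y => by
    rcases h3 x y with h | h | h
    · exact .inr (.inr h)
    · exact .inr (.inl h)
    · exact .inl h, h4, h5, h6, h7, h9, h8⟩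

theorem TFrame.Descriptive.op (hg : F.IsGeneral) (hd : F.Descriptive) : F.op.Descriptive := by
  obtain ⟨-, -, -, -, -, -, hc, hF, -⟩ := hg
  refine ⟨hd.1, fun x y => ⟨fun h X _ hy => ⟨y, hy, h⟩, fun h => ?_⟩, hd.2.2⟩
  refine (hd.2.1 y x).2 fun X hX hx => ?_
  by_contra hn
  obtain ⟨z, hz, hzx⟩ := h _ (hc _ (hF _ hX)) hn
  exact hz ⟨x, hx, hzx⟩

theorem TFrame.exists_max (hg : F.IsGeneral) (hd : F.Descriptive) {X : Set W} (hX : X ∈ F.P)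
    (hne : X.Nonempty) : ∃ m ∈ X, ∀ y ∈ X, y = m ∨ F.R y m := by
  have hg' := hg
  obtain ⟨-, -, -, -, hu, hi, hc, hF, -⟩ := hg'
  let 𝒳 : Set (Set W) := {Z | ∃ A ∈ F.P, (∀ x ∈ A, ∀ y, F.R x y → y ∈ A) ∧
    (X ∩ A).Nonempty ∧ Z = X ∩ A}
  have hfin : ∀ 𝒴 : Set (Set W), 𝒴.Finite → 𝒴 ⊆ 𝒳 → ∃ A ∈ F.P,
      (∀ x ∈ A, ∀ y, F.R x y → y ∈ A) ∧ (X ∩ A).Nonempty ∧ X ∩ A ⊆ ⋂₀ 𝒴 := by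
    intro 𝒴 hfin
    induction 𝒴, hfin using Set.Finite.induction_on with
    | empty => exact fun _ => ⟨Set.univ, hu, by simp, by simpa using hne, by simp⟩
    | @insert Z 𝒴 _ _ ih =>
      intro hs
      obtain ⟨A, hA, hAu, hAn, hAs⟩ := ih fun Y hY => hs (Set.mem_insert_of_mem _ hY)
      obtain ⟨B, hB, hBu, hBn, rfl⟩ := hs (Set.mem_insert _ _)
      by_cases hAB : A ⊆ B
      · refine ⟨A, hA, hAu, hAn, ?_⟩
        rw [Set.sInter_insert]
        exact Set.subset_inter (Set.inter_subset_inter_right _ hAB) hAs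
      · obtain ⟨a, ha, hab⟩ := Set.not_subset.1 hAB
        have hBA : B ⊆ A := by
          intro b hb
          rcases hg.conn a b with h | h | h
          · exact hAu a ha b h
          · exact h ▸ ha
          · exact absurd (hBu b hb a h) hab
        refine ⟨B, hB, hBu, hBn, ?_⟩
        rw [Set.sInter_insert]
        exact Set.subset_inter le_rfl ((Set.inter_subset_inter_right _ hBA).trans hAs)
  obtain ⟨m, hm⟩ := hd.2.2 𝒳
    (by rintro _ ⟨A, hA, -, -, rfl⟩; exact hi _ hX _ hA)
    (fun 𝒴 hs hf => by
      obtain ⟨A, -, -, hn, hsub⟩ := hfin 𝒴 hf hs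
      exact hn.mono hsub)
  have hmX : m ∈ X :=
    (hm (X ∩ Set.univ) ⟨Set.univ, hu, by simp, by simpa using hne, rfl⟩).1
  refine ⟨m, hmX, fun y hy => ?_⟩
  by_contra! hcon
  obtain ⟨hym, hRym⟩ := hcon
  obtain ⟨Y, hY, hmY, hyY⟩ : ∃ Y ∈ F.P, m ∈ Y ∧ y ∉ F.diaF Y := by
    by_contra! hcon
    exact hRym ((hd.2.1 y m).2 hcon)
  obtain ⟨Z, hZ, hmZ, hyZ⟩ : ∃ Z ∈ F.P, m ∈ Z ∧ y ∉ Z := by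
    by_contra! hcon
    refine hym (hd.1 y m fun Z hZ => ⟨fun h => ?_, hcon Z hZ⟩)
    by_contra hn
    exact hcon _ (hc _ hZ) hn h
  have hYZ := hi _ hY _ hZ
  have hA := hm _ ⟨(Y ∩ Z ∪ F.diaF (Y ∩ Z))ᶜ, hc _ (hg.union_mem hYZ (hF _ hYZ)), ?_,
    ⟨y, hy, ?_⟩, rfl⟩
  · exact hA.2 (.inl ⟨hmY, hmZ⟩)
  · rintro a ha b hab (hb | ⟨c, hc, hbc⟩)
    · exact ha (.inr ⟨b, hb, hab⟩)
    · exact ha (.inr ⟨c, hc, hg.trans hab hbc⟩)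
  · rintro (h | ⟨c, hc, hyc⟩)
    · exact hyZ h.2
    · exact hyY ⟨c, hc.1, hyc⟩

theorem TFrame.exists_min (hg : F.IsGeneral) (hd : F.Descriptive) {X : Set W} (hX : X ∈ F.P)
    (hne : X.Nonempty) : ∃ m ∈ X, ∀ y ∈ X, y = m ∨ F.R m y :=
  TFrame.exists_max (F := F.op) hg.op (hd.op hg) hX hne

theorem TFrame.singleton_mem (hg : F.IsGeneral) (hd : F.Descriptive) {x : W} (hx : ¬ F.R x x) :
    {x} ∈ F.P := by
  have hg' := hg
  obtain ⟨-, -, -, -, -, hi, hc, hF, -⟩ := hg'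
  obtain ⟨X, hX, hxX, hxn⟩ : ∃ X ∈ F.P, x ∈ X ∧ x ∉ F.diaF X := by
    by_contra! hcon
    exact hx ((hd.2.1 x x).2 hcon)
  have heq : {x} = X ∩ (F.diaF X)ᶜ := by
    ext y
    constructor
    · rintro rfl
      exact ⟨hxX, hxn⟩
    · rintro ⟨hyX, hyn⟩
      rcases hg.conn x y with h | h | h
      · exact absurd ⟨y, hyX, h⟩ hxn
      · exact h.symm
      · exact absurd ⟨x, hxX, h⟩ hyn
  rw [heq]
  exact hi _ hX _ (hc _ (hF _ hX))

theorem TFrame.setOf_clLT_max_mem (hg : F.IsGeneral) {X : Set W} (hX : X ∈ F.P) {m : W}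
    (hm : m ∈ X) (hmax : ∀ y ∈ X, y = m ∨ F.R y m) (hr : F.R m m) :
    {z | F.clLT m z} ∈ F.P := by
  have hg' := hg
  obtain ⟨-, -, -, -, -, -, hc, hF, -⟩ := hg'
  have heq : {z | F.clLT m z} = (F.diaF X)ᶜ := by
    ext z
    constructor
    · rintro ⟨-, h⟩ ⟨y, hy, hzy⟩
      rcases hmax y hy with rfl | h'
      · exact h hzy
      · exact h (hg.trans hzy h')
    · intro h
      have hzm : ¬ F.R z m := fun h' => h ⟨m, hm, h'⟩
      rcases hg.conn m z with h' | rfl | h'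
      · exact ⟨h', hzm⟩
      · exact absurd hr hzm
      · exact absurd h' hzm
  rw [heq]
  exact hc _ (hF _ hX)

theorem TFrame.setOf_clLT_min_mem (hg : F.IsGeneral) {X : Set W} (hX : X ∈ F.P) {m : W}
    (hm : m ∈ X) (hmin : ∀ y ∈ X, y = m ∨ F.R m y) (hr : F.R m m) :
    {z | F.clLT z m} ∈ F.P :=
  TFrame.setOf_clLT_max_mem (F := F.op) hg.op hX hm hmin hr

theorem TFrame.IsGeneral.finset_max (hg : F.IsGeneral) (S : Finset W) (hS : S.Nonempty) :
    ∃ m ∈ S, ∀ s ∈ S, s = m ∨ F.R s m := by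
  induction hS using Finset.Nonempty.cons_induction with
  | singleton a => exact ⟨a, by simp, by simp⟩
  | cons a s _ _ ih =>
    obtain ⟨m, hm, h⟩ := ih
    simp only [Finset.mem_cons]
    rcases hg.conn a m with ham | ham | ham
    · exact ⟨m, .inr hm, by rintro s (rfl | hs); exacts [.inr ham, h s hs]⟩
    · exact ⟨m, .inr hm, by rintro s (rfl | hs); exacts [.inl ham, h s hs]⟩
    · refine ⟨a, .inl rfl, ?_⟩
      rintro s (rfl | hs)
      · exact .inl rfl
      · rcases h s hs with rfl | h'
        · exact .inr ham
        · exact .inr (hg.trans h' ham)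

theorem TFrame.Serial.exists_final (hg : F.IsGeneral) (hs : F.Serial) : ∃ z, ∀ y, F.R y z := by
  obtain ⟨⟨x, hx, hr⟩, -⟩ := hs
  refine ⟨x, fun y => ?_⟩
  rcases hg.conn y x with h | rfl | h
  · exact h
  · exact hr
  · by_contra hn
    exact hx y ⟨h, hn⟩

theorem TFrame.Serial.exists_initial (hg : F.IsGeneral) (hs : F.Serial) :
    ∃ z, ∀ y, F.R z y :=
  TFrame.Serial.exists_final (F := F.op) hg.op ⟨hs.2, hs.1⟩

theorem TModel.setOf_sat_mem (hg : F.IsGeneral) {v : ℕ → Set W} (hv : ∀ p, v p ∈ F.P)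
    (φ : TMF) : {x | (TModel.mk F v).sat x φ} ∈ F.P := by
  obtain ⟨-, -, -, he, hu, hi, hc, hF, hP⟩ := hg
  induction φ with
  | var p => exact hv p
  | top => exact hu
  | bot => exact he
  | neg φ ih => exact hc _ ih
  | and φ ψ ih1 ih2 => exact hi _ ih1 _ ih2
  | diaF φ ih =>
    convert hF _ ih using 1
    ext x
    simp [TFrame.diaF, TModel.sat, and_comm]
  | diaP φ ih =>
    convert hP _ ih using 1
    ext x
    simp [TFrame.diaP, TModel.sat, and_comm]

end InternalSets

/-! ## Transfer of refutations to Kripke frames -/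

section Transfer

variable {W : Type} {F : TFrame W}

theorem TMF.self_mem_subs (φ : TMF) : φ ∈ φ.subs := by cases φ <;> simp [TMF.subs]

/-- Each subformula of `φ` true at a point has a witness in `A` weakly above it and a witness in
`B` weakly below it. -/
def TModel.Adequate (M : TModel W) (φ : TMF) (A B : Set W) : Prop :=
  ∀ ψ ∈ φ.subs, ∀ y, M.sat y ψ →
    (∃ m ∈ A, M.sat m ψ ∧ (y = m ∨ M.F.R y m)) ∧ (∃ m ∈ B, M.sat m ψ ∧ (y = m ∨ M.F.R m y))

/-- `f` is a homomorphism from `(T, r)` to `F` that realises the points of `A` and `B`, and the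
points of `A` in the future and the points of `B` in the past wherever they are visible. -/
structure TFrame.Covers (F : TFrame W) (A B : Set W) {T : Type} (r : T → T → Prop) (f : T → W) :
    Prop where
  hom : ∀ s t, r s t → F.R (f s) (f t)
  future : ∀ s, ∀ x ∈ A, F.R (f s) x → ∃ t, r s t ∧ f t = x
  past : ∀ s, ∀ x ∈ B, F.R x (f s) → ∃ t, r t s ∧ f t = x
  surj : ∀ x ∈ A ∪ B, ∃ t, f t = x

theorem TModel.Adequate.sat_iff (hg : F.IsGeneral) {v : ℕ → Set W} {A B : Set W} {T : Type}
    {r : T → T → Prop} {f : T → W} (hf : F.Covers A B r f) (φ : TMF)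
    (h : (TModel.mk F v).Adequate φ A B) (t : T) :
    (TModel.mk (tKripke T r) fun p => f ⁻¹' v p).sat t φ ↔ (TModel.mk F v).sat (f t) φ := by
  induction φ generalizing t with
  | var p => exact Iff.rfl
  | top => exact Iff.rfl
  | bot => exact Iff.rfl
  | neg φ ih =>
    exact not_congr (ih (fun ψ hψ => h ψ (by simp [TMF.subs, hψ])) t)
  | and φ ψ ih1 ih2 =>
    exact and_congr (ih1 (fun χ hχ => h χ (by simp [TMF.subs, hχ])) t)
      (ih2 (fun χ hχ => h χ (by simp [TMF.subs, hχ])) t)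
  | diaF φ ih =>
    have ih := ih fun ψ hψ => h ψ (by simp [TMF.subs, hψ])
    constructor
    · rintro ⟨s, hts, hs⟩
      exact ⟨f s, hf.hom _ _ hts, (ih s).1 hs⟩
    · rintro ⟨y, hy, hyφ⟩
      obtain ⟨m, hm, hmφ, hym⟩ := (h φ (by simp [TMF.subs, TMF.self_mem_subs]) y hyφ).1
      have hR : F.R (f t) m := by
        rcases hym with rfl | hym
        exacts [hy, hg.trans hy hym]
      obtain ⟨s, hts, rfl⟩ := hf.future t m hm hR
      exact ⟨s, hts, (ih s).2 hmφ⟩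
  | diaP φ ih =>
    have ih := ih fun ψ hψ => h ψ (by simp [TMF.subs, hψ])
    constructor
    · rintro ⟨s, hts, hs⟩
      exact ⟨f s, hf.hom _ _ hts, (ih s).1 hs⟩
    · rintro ⟨y, hy, hyφ⟩
      obtain ⟨m, hm, hmφ, hym⟩ := (h φ (by simp [TMF.subs, TMF.self_mem_subs]) y hyφ).2
      have hR : F.R m (f t) := by
        rcases hym with rfl | hym
        exacts [hy, hg.trans hym hy]
      obtain ⟨s, hts, rfl⟩ := hf.past t m hm hR
      exact ⟨s, hts, (ih s).2 hmφ⟩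

theorem TModel.exists_adequate (hg : F.IsGeneral) {v : ℕ → Set W} (hv : ∀ p, v p ∈ F.P)
    {Q Q' : W → Prop}
    (hmax : ∀ X ∈ F.P, X.Nonempty → ∃ m ∈ X, Q m ∧ ∀ y ∈ X, y = m ∨ F.R y m)
    (hmin : ∀ X ∈ F.P, X.Nonempty → ∃ m ∈ X, Q' m ∧ ∀ y ∈ X, y = m ∨ F.R m y) (φ : TMF) :
    ∃ A B : Finset W, (∀ a ∈ A, Q a) ∧ (∀ b ∈ B, Q' b) ∧
      (TModel.mk F v).Adequate φ A B := by
  classical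
  obtain ⟨x₀⟩ := hg.1
  have hu : (Set.univ : Set W) ∈ F.P := hg.2.2.2.2.1
  obtain ⟨a₀, -, ha₀, -⟩ := hmax _ hu ⟨x₀, trivial⟩
  obtain ⟨b₀, -, hb₀, -⟩ := hmin _ hu ⟨x₀, trivial⟩
  have h1 : ∀ ψ, ∃ m, Q m ∧ ∀ y, (TModel.mk F v).sat y ψ →
      (TModel.mk F v).sat m ψ ∧ (y = m ∨ F.R y m) := by
    intro ψ
    by_cases hne : {x | (TModel.mk F v).sat x ψ}.Nonempty
    · obtain ⟨m, hm, hq, h⟩ := hmax _ (TModel.setOf_sat_mem hg hv ψ) hne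
      exact ⟨m, hq, fun y hy => ⟨hm, h y hy⟩⟩
    · exact ⟨a₀, ha₀, fun y hy => absurd ⟨y, hy⟩ hne⟩
  have h2 : ∀ ψ, ∃ m, Q' m ∧ ∀ y, (TModel.mk F v).sat y ψ →
      (TModel.mk F v).sat m ψ ∧ (y = m ∨ F.R m y) := by
    intro ψ
    by_cases hne : {x | (TModel.mk F v).sat x ψ}.Nonempty
    · obtain ⟨m, hm, hq, h⟩ := hmin _ (TModel.setOf_sat_mem hg hv ψ) hne
      exact ⟨m, hq, fun y hy => ⟨hm, h y hy⟩⟩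
    · exact ⟨b₀, hb₀, fun y hy => absurd ⟨y, hy⟩ hne⟩
  choose a ha using h1
  choose b hb using h2
  refine ⟨φ.subs.image a, φ.subs.image b, ?_, ?_, fun ψ hψ y hy => ⟨?_, ?_⟩⟩
  · simp only [Finset.mem_image, forall_exists_index, and_imp]
    rintro _ ψ - rfl
    exact (ha ψ).1
  · simp only [Finset.mem_image, forall_exists_index, and_imp]
    rintro _ ψ - rfl
    exact (hb ψ).1
  · exact ⟨a ψ, by simpa using ⟨ψ, hψ, rfl⟩, (ha ψ).2 y hy⟩
  · exact ⟨b ψ, by simpa using ⟨ψ, hψ, rfl⟩, (hb ψ).2 y hy⟩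

theorem TFrame.valid_of_covers (hg : F.IsGeneral) {Q Q' : W → Prop}
    (hmax : ∀ X ∈ F.P, X.Nonempty → ∃ m ∈ X, Q m ∧ ∀ y ∈ X, y = m ∨ F.R y m)
    (hmin : ∀ X ∈ F.P, X.Nonempty → ∃ m ∈ X, Q' m ∧ ∀ y ∈ X, y = m ∨ F.R m y) {φ : TMF}
    (h : ∀ A B : Finset W, A.Nonempty → (∀ a ∈ A, Q a) → (∀ b ∈ B, Q' b) →
      ∃ (T : Type) (r : T → T → Prop) (f : T → W), (tKripke T r).Valid φ ∧ F.Covers A B r f) :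
    F.Valid φ := by
  intro v hv x
  by_contra hx
  obtain ⟨A, B, hA, hB, had⟩ := TModel.exists_adequate hg hv hmax hmin (.neg φ)
  obtain ⟨m, hm, hmφ, -⟩ := (had _ (TMF.self_mem_subs _) x hx).1
  obtain ⟨T, r, f, hval, hf⟩ := h A B ⟨m, hm⟩ hA hB
  obtain ⟨t, rfl⟩ := hf.surj m (.inl hm)
  exact (had.sat_iff hg hf _ t).2 hmφ (hval _ (fun _ => trivial) t)

theorem TFrame.Covers.mono {A B A' B' : Set W} {T : Type} {r : T → T → Prop} {f : T → W}
    (h : F.Covers A B r f) (hA : A' ⊆ A) (hB : B' ⊆ B) : F.Covers A' B' r f where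
  hom := h.hom
  future s x hx := h.future s x (hA hx)
  past s x hx := h.past s x (hB hx)
  surj x hx := h.surj x (Set.union_subset_union hA hB hx)

theorem TFrame.Covers.comp {A B : Set W} {T T' : Type} {r : T → T → Prop} {r' : T' → T' → Prop}
    {f : T → W} (h : F.Covers A B r f) (e : r' ≃r r) : F.Covers A B r' (f ∘ e) where
  hom s t hst := h.hom _ _ (e.map_rel_iff.2 hst)
  future s x hx hR := by
    obtain ⟨t, ht, rfl⟩ := h.future _ x hx hR
    exact ⟨e.symm t, by simpa [← e.map_rel_iff] using ht, by simp⟩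
  past s x hx hR := by
    obtain ⟨t, ht, rfl⟩ := h.past _ x hx hR
    exact ⟨e.symm t, by simpa [← e.map_rel_iff] using ht, by simp⟩
  surj x hx := by
    obtain ⟨t, rfl⟩ := h.surj x hx
    exact ⟨e.symm t, by simp⟩

theorem TFrame.Covers.sum {A B A' B' : Set W} {T T' : Type} {r : T → T → Prop}
    {r' : T' → T' → Prop} {f : T → W} {f' : T' → W} (h : F.Covers A B r f)
    (h' : F.Covers A' B' r' f') (hlt : ∀ a b, F.clLT (f a) (f' b)) :
    F.Covers (A ∪ A') (B ∪ B') (Sum.Lex r r') (Sum.elim f f') where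
  hom s t hst := by
    cases hst with
    | inl hst => exact h.hom _ _ hst
    | inr hst => exact h'.hom _ _ hst
    | sep a b => exact (hlt a b).1
  future s x hx hR := by
    rcases s with a | b <;> rcases hx with hx | hx
    · obtain ⟨t, ht, rfl⟩ := h.future _ x hx hR
      exact ⟨.inl t, .inl ht, rfl⟩
    · obtain ⟨t, rfl⟩ := h'.surj x (.inl hx)
      exact ⟨.inr t, .sep _ _, rfl⟩
    · obtain ⟨t, rfl⟩ := h.surj x (.inl hx)
      exact absurd hR (hlt t b).2
    · obtain ⟨t, ht, rfl⟩ := h'.future _ x hx hR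
      exact ⟨.inr t, .inr ht, rfl⟩
  past s x hx hR := by
    rcases s with a | b <;> rcases hx with hx | hx
    · obtain ⟨t, ht, rfl⟩ := h.past _ x hx hR
      exact ⟨.inl t, .inl ht, rfl⟩
    · obtain ⟨t, rfl⟩ := h'.surj x (.inr hx)
      exact absurd hR (hlt a t).2
    · obtain ⟨t, rfl⟩ := h.surj x (.inr hx)
      exact ⟨.inl t, .sep _ _, rfl⟩
    · obtain ⟨t, ht, rfl⟩ := h'.past _ x hx hR
      exact ⟨.inr t, .inr ht, rfl⟩
  surj x hx := by
    rcases hx with (hx | hx) | (hx | hx)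
    · obtain ⟨t, rfl⟩ := h.surj x (.inl hx)
      exact ⟨.inl t, rfl⟩
    · obtain ⟨t, rfl⟩ := h'.surj x (.inl hx)
      exact ⟨.inr t, rfl⟩
    · obtain ⟨t, rfl⟩ := h.surj x (.inr hx)
      exact ⟨.inl t, rfl⟩
    · obtain ⟨t, rfl⟩ := h'.surj x (.inr hx)
      exact ⟨.inr t, rfl⟩

theorem TFrame.covers_unit {d : W} (hd : ¬ F.R d d) :
    F.Covers {d} {d} (fun _ _ : Unit => False) (fun _ => d) where
  hom _ _ h := h.elim
  future _ x hx hR := absurd (by rwa [Set.mem_singleton_iff.1 hx] at hR) hd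
  past _ x hx hR := absurd (by rwa [Set.mem_singleton_iff.1 hx] at hR) hd
  surj x hx := ⟨(), by simpa [eq_comm] using hx⟩

theorem TFrame.covers_subtype (S : Set W) :
    F.Covers S S (fun a b : S => F.R a b) Subtype.val where
  hom _ _ h := h
  future _ x hx hR := ⟨⟨x, hx⟩, hR, rfl⟩
  past _ x hx hR := ⟨⟨x, hx⟩, hR, rfl⟩
  surj x hx := ⟨⟨x, by simpa using hx⟩, rfl⟩

/-- An enumeration of a nonempty finite set. -/
theorem Finset.exists_nat_enum {S : Finset W} (hS : S.Nonempty) :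
    ∃ g : ℕ → W, (∀ n, g n ∈ S) ∧ ∀ x ∈ S, ∃ n, g n = x := by
  have : Nonempty S := hS.to_subtype
  obtain ⟨g, hg⟩ := exists_surjective_nat S
  refine ⟨fun n => g n, fun n => (g n).2, fun x hx => ?_⟩
  obtain ⟨n, hn⟩ := hg ⟨x, hx⟩
  exact ⟨n, by simp [hn]⟩

/-- The order `r` carries a labelling by natural numbers in which every label is cofinal in both
directions. -/
def HasCofinalLabels {T : Type} (r : T → T → Prop) : Prop :=
  ∃ l : T → ℕ, ∀ s n, (∃ t, r s t ∧ l t = n) ∧ (∃ t, r t s ∧ l t = n)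

theorem TFrame.exists_covers_cluster {T : Type} [Nonempty T] {r : T → T → Prop}
    (hr : HasCofinalLabels r) {S : Finset W} (hS : S.Nonempty)
    (hcl : ∀ a ∈ S, ∀ b ∈ S, F.R a b) : ∃ f : T → W, F.Covers S S r f ∧ ∀ t, f t ∈ S := by
  obtain ⟨l, hl⟩ := hr
  obtain ⟨g, hgS, hg⟩ := Finset.exists_nat_enum hS
  refine ⟨g ∘ l, ⟨fun s t _ => hcl _ (hgS _) _ (hgS _), fun s x hx _ => ?_, fun s x hx _ => ?_,
    fun x hx => ?_⟩, fun t => hgS _⟩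
  · obtain ⟨n, rfl⟩ := hg x hx
    obtain ⟨t, ht, rfl⟩ := (hl s n).1
    exact ⟨t, ht, rfl⟩
  · obtain ⟨n, rfl⟩ := hg x hx
    obtain ⟨t, ht, rfl⟩ := (hl s n).2
    exact ⟨t, ht, rfl⟩
  · obtain ⟨n, rfl⟩ := hg x (by simpa using hx)
    obtain ⟨t, -, rfl⟩ := (hl (Classical.arbitrary T) n).1
    exact ⟨t, rfl⟩

theorem hasCofinalLabels_lt (T : Type) [Ring T] [LinearOrder T] [IsStrictOrderedRing T]
    [FloorRing T] [Archimedean T] : HasCofinalLabels (fun a b : T => a < b) := by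
  have hk : ∀ (s : T) (n : ℕ), ∃ k : ℕ, s < (Nat.pair n k : T) := by
    intro s n
    obtain ⟨k, hk⟩ := exists_nat_gt s
    exact ⟨k, hk.trans_le (by exact_mod_cast Nat.right_le_pair n k)⟩
  refine ⟨fun t => (Nat.unpair ⌊|t|⌋₊).1, fun s n => ⟨?_, ?_⟩⟩
  · obtain ⟨k, hk⟩ := hk s n
    exact ⟨_, hk, by simp⟩
  · obtain ⟨k, hk⟩ := hk (-s) n
    exact ⟨_, neg_lt.1 hk, by simp⟩

end Transfer

/-! ## Covers by dense orders -/

section DenseCovers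

variable {W : Type} {F : TFrame W}

theorem TFrame.DenseFrm.exists_covers_aux (hg : F.IsGeneral) (hdn : F.DenseFrm) {T : Type}
    [Nonempty T] {r : T → T → Prop} (hr : HasCofinalLabels r)
    (e3 : r ≃r Sum.Lex r (Sum.Lex (fun _ _ : Unit => False) r))
    (h2 : Nonempty (r ≃r Sum.Lex r r) ∨ F.DedekindComplete) (n : ℕ) :
    ∀ S : Finset W, S.card ≤ n → ∀ x ∈ S, ∀ y ∈ S, F.R x x → F.R y y →
      (∀ s ∈ S, F.R x s ∧ F.R s y) → ∃ f : T → W, F.Covers S S r f ∧ ∀ t, F.R (f t) y := by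
  classical
  induction n with
  | zero =>
    intro S hS x hx
    exact absurd (Finset.card_pos.2 ⟨x, hx⟩) (by omega)
  | succ n ih =>
  intro S hS x hx y hy hxx hyy hxy
  set top := S.filter (F.R y ·) with htop
  set rest := S.filter (¬ F.R y ·) with hrest
  have hS_eq : S = rest ∪ top := by
    rw [htop, hrest, Finset.union_comm, Finset.filter_union_filter_not_eq]
  have htop_y : ∀ b ∈ top, F.R y b ∧ F.R b y := fun b hb =>
    ⟨(Finset.mem_filter.1 hb).2, (hxy b (Finset.mem_filter.1 hb).1).2⟩
  have hrest_y : ∀ b ∈ rest, F.clLT b y := fun b hb =>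
    ⟨(hxy b (Finset.mem_filter.1 hb).1).2, (Finset.mem_filter.1 hb).2⟩
  have hy_top : y ∈ top := Finset.mem_filter.2 ⟨hy, hyy⟩
  have hcard : rest.card ≤ n := by
    have : rest.card < S.card := Finset.card_lt_card
      (Finset.filter_ssubset.2 ⟨y, hy, not_not.2 hyy⟩)
    omega
  obtain ⟨f₂, hf₂, hf₂_top⟩ := TFrame.exists_covers_cluster hr ⟨y, hy_top⟩
    fun a ha b hb => hg.trans (htop_y a ha).2 (htop_y b hb).1
  rcases rest.eq_empty_or_nonempty with he | hne
  · rw [he, Finset.empty_union] at hS_eq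
    exact ⟨f₂, hS_eq ▸ hf₂, fun t => (htop_y _ (hf₂_top t)).2⟩
  -- Gluing a cover below `d`, the point `d` and the cover of the top cluster.
  have glue : ∀ (S' : Finset W) (f₁ : T → W) (d : W), F.Covers S' S' r f₁ → ¬ F.R d d →
      (∀ t, F.R (f₁ t) d) → F.R d y → (∀ s ∈ rest, s = d ∨ s ∈ S') →
      ∃ f : T → W, F.Covers S S r f ∧ ∀ t, F.R (f t) y := by
    intro S' f₁ d hf₁ hdd hf₁d hdy hsub
    have h1 : ∀ t, F.clLT d (f₂ t) := fun t =>
      ⟨hg.trans hdy (htop_y _ (hf₂_top t)).1, fun h => hdd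
        (hg.trans hdy (hg.trans (htop_y _ (hf₂_top t)).1 h))⟩
    have h2 : ∀ t, F.clLT (f₁ t) d := fun t =>
      ⟨hf₁d t, fun h => hdd (hg.trans h (hf₁d t))⟩
    have hc := (hf₁.sum ((TFrame.covers_unit hdd).sum hf₂ fun _ => h1) (by
      rintro a (b | b)
      · exact h2 a
      · exact ⟨hg.trans (h2 a).1 (h1 b).1, fun h => (h1 b).2 (hg.trans h (h2 a).1)⟩)).comp e3
    have hsub' : (S : Set W) ⊆ ↑S' ∪ ({d} ∪ ↑top) := by
      intro s hs
      rw [hS_eq] at hs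
      rcases Finset.mem_union.1 (Finset.mem_coe.1 hs) with h | h
      · rcases hsub s h with rfl | h
        · exact .inr (.inl rfl)
        · exact .inl h
      · exact .inr (.inr h)
    refine ⟨_, hc.mono hsub' hsub', fun t => ?_⟩
    simp only [Function.comp]
    rcases e3 t with a | b | c
    · exact hg.trans (hf₁d a) hdy
    · exact hdy
    · exact (htop_y _ (hf₂_top c)).2
  have hx_rest : x ∈ rest := by
    refine Finset.mem_filter.2 ⟨hx, fun h => ?_⟩
    obtain ⟨b, hb⟩ := hne
    exact (hrest_y b hb).2 (hg.trans h (hxy b (Finset.mem_filter.1 hb).1).1)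
  have hx_le : ∀ s ∈ rest, F.R x s := fun s hs => (hxy s (Finset.mem_filter.1 hs).1).1
  obtain ⟨u, hu, hmax⟩ := hg.finset_max rest hne
  by_cases huu : F.R u u
  · have hmax' : ∀ s ∈ rest, F.R s u := fun s hs => by
      rcases hmax s hs with rfl | h
      exacts [huu, h]
    obtain ⟨f₁, hf₁, hf₁u⟩ := ih rest hcard x hx_rest u hu hxx huu
      fun s hs => ⟨hx_le s hs, hmax' s hs⟩
    have huy := hrest_y u hu
    rcases h2 with ⟨⟨e2⟩⟩ | hded
    · have hc := (hf₁.sum hf₂ fun a b => ⟨hg.trans (hf₁u a) (hg.trans huy.1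
        (htop_y _ (hf₂_top b)).1), fun h => huy.2 (hg.trans (htop_y _ (hf₂_top b)).1
          (hg.trans h (hf₁u a)))⟩).comp e2
      have hcoe : (S : Set W) ⊆ ↑rest ∪ ↑top := by
        rw [← Finset.coe_union, ← hS_eq]
      refine ⟨_, hc.mono hcoe hcoe, fun t => ?_⟩
      simp only [Function.comp]
      rcases e2 t with a | c
      · exact hg.trans (hf₁u a) huy.1
      · exact (htop_y _ (hf₂_top c)).2
    · obtain ⟨d, hdd, hud, hdy⟩ := hded u y huu hyy huy
      exact glue rest f₁ d hf₁ hdd (fun t => hg.trans (hf₁u t) hud.1) hdy.1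
        fun s hs => .inr hs
  · have hxu : x ≠ u := by rintro rfl; exact huu hxx
    have hmax' : ∀ s ∈ rest.erase u, F.clLT s u := fun s hs => by
      have hs' := Finset.mem_erase.1 hs
      have hsu := (hmax s hs'.2).resolve_left hs'.1
      exact ⟨hsu, fun h => huu (hg.trans h hsu)⟩
    have hx' : x ∈ rest.erase u := Finset.mem_erase.2 ⟨hxu, hx_rest⟩
    obtain ⟨u', hu', hmax''⟩ := hg.finset_max (rest.erase u) ⟨x, hx'⟩
    obtain ⟨w, hww, hwu, hw⟩ : ∃ w, F.R w w ∧ F.R w u ∧ ∀ s ∈ rest.erase u, F.R s w := by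
      by_cases hu'u' : F.R u' u'
      · refine ⟨u', hu'u', (hmax' u' hu').1, fun s hs => ?_⟩
        rcases hmax'' s hs with rfl | h
        exacts [hu'u', h]
      · obtain ⟨w, hww, hw1, hw2⟩ := hdn u' u hu'u' huu (hmax' u' hu')
        refine ⟨w, hww, hw2.1, fun s hs => ?_⟩
        rcases hmax'' s hs with rfl | h
        exacts [hw1.1, hg.trans h hw1.1]
    have hcard' : (insert w (rest.erase u)).card ≤ n := by
      have h1 := Finset.card_insert_le w (rest.erase u)
      have h2 := Finset.card_erase_add_one hu
      omega
    obtain ⟨f₁, hf₁, hf₁w⟩ := ih (insert w (rest.erase u)) hcard' x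
      (Finset.mem_insert_of_mem hx') w (Finset.mem_insert_self _ _) hxx hww (by
        intro s hs
        rcases Finset.mem_insert.1 hs with rfl | hs
        · exact ⟨hw x hx', hww⟩
        · exact ⟨hx_le s (Finset.mem_of_mem_erase hs), hw s hs⟩)
    refine glue _ f₁ u hf₁ huu (fun t => hg.trans (hf₁w t) hwu) (hrest_y u hu).1 fun s hs => ?_
    by_cases hsu : s = u
    · exact .inl hsu
    · exact .inr (Finset.mem_insert_of_mem (Finset.mem_erase.2 ⟨hsu, hs⟩))

theorem TFrame.valid_of_dense (hg : F.IsGeneral) (hd : F.Descriptive) (hs : F.Serial)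
    (hdn : F.DenseFrm) {T : Type} [Nonempty T] {r : T → T → Prop} (hr : HasCofinalLabels r)
    (e3 : r ≃r Sum.Lex r (Sum.Lex (fun _ _ : Unit => False) r))
    (h2 : Nonempty (r ≃r Sum.Lex r r) ∨ F.DedekindComplete) {φ : TMF}
    (hφ : (tKripke T r).Valid φ) : F.Valid φ := by
  classical
  refine TFrame.valid_of_covers hg (Q := fun _ => True) (Q' := fun _ => True)
    (fun X hX hne => ?_) (fun X hX hne => ?_) fun A B _ _ _ => ?_
  · obtain ⟨m, hm, h⟩ := TFrame.exists_max hg hd hX hne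
    exact ⟨m, hm, trivial, h⟩
  · obtain ⟨m, hm, h⟩ := TFrame.exists_min hg hd hX hne
    exact ⟨m, hm, trivial, h⟩
  · obtain ⟨z, hz⟩ := hs.exists_final hg
    obtain ⟨a, ha⟩ := hs.exists_initial hg
    obtain ⟨f, hf, -⟩ := hdn.exists_covers_aux hg hr e3 h2 _ (insert a (insert z (A ∪ B))) le_rfl
      a (by simp) z (by simp) (ha a) (hz z) (fun s _ => ⟨ha s, hz s⟩)
    refine ⟨T, r, f, hφ, hf.mono ?_ ?_⟩ <;>
    · intro s hs
      simp only [Finset.mem_coe] at hs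
      simp [hs]

end DenseCovers

/-! ## Decompositions of the standard orders -/

section Decompositions

/-- An order isomorphism onto a lexicographic sum, as an isomorphism of strict orders. -/
theorem exists_relIso_of_strictMono {T T' : Type} [LinearOrder T] {r : T' → T' → Prop}
    (hr : ∀ a b, r a b ∨ a = b ∨ r b a) (g : T' → T) (hg : ∀ a b, r a b → g a < g b)
    (hs : Function.Surjective g) : Nonempty ((fun a b : T => a < b) ≃r r) := by
  have hinj : Function.Injective g := by
    intro a b hab
    rcases hr a b with h | h | h
    · exact absurd (hg _ _ h) (by simp [hab])
    · exact h
    · exact absurd (hg _ _ h) (by simp [hab])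
  refine ⟨RelIso.symm ⟨Equiv.ofBijective g ⟨hinj, hs⟩, fun {a b} => ⟨fun h => ?_, hg a b⟩⟩⟩
  rcases hr a b with h' | h' | h'
  · exact h'
  · subst h'
    exact absurd h (lt_irrefl _)
  · exact absurd (hg _ _ h') (lt_asymm h)

theorem sumLex_connected {α β : Type} {r : α → α → Prop} {s : β → β → Prop}
    (hr : ∀ a b, r a b ∨ a = b ∨ r b a) (hs : ∀ a b, s a b ∨ a = b ∨ s b a) (a b : α ⊕ β) :
    Sum.Lex r s a b ∨ a = b ∨ Sum.Lex r s b a := by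
  rcases a with a | a <;> rcases b with b | b
  · simpa using hr a b
  · simp
  · simp
  · simpa using hs a b

theorem lt_connected {T : Type} [LinearOrder T] (a b : T) : a < b ∨ a = b ∨ b < a :=
  lt_trichotomy a b

theorem real_relIso_sum_unit_sum : Nonempty ((fun a b : ℝ => a < b) ≃r
    Sum.Lex (fun a b : ℝ => a < b) (Sum.Lex (fun _ _ : Unit => False) fun a b : ℝ => a < b)) := by
  refine exists_relIso_of_strictMono
    (sumLex_connected lt_connected (sumLex_connected (by simp) lt_connected))
    (Sum.elim (fun a => -Real.exp (-a)) (Sum.elim (fun _ => 0) Real.exp)) ?_ ?_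
  · rintro _ _ (h | h | _)
    · simpa using h
    · rcases h with h | h | _
      · exact h.elim
      · simpa using h
      · simpa using Real.exp_pos _
    · rename_i a b
      rcases b with b | b
      · simpa using Real.exp_pos _
      · simpa using (neg_lt_zero.2 (Real.exp_pos _)).trans (Real.exp_pos _)
  · intro t
    rcases lt_trichotomy t 0 with h | h | h
    · exact ⟨.inl (-Real.log (-t)), by simp [-Real.log_neg_eq_log, Real.exp_log (neg_pos.2 h)]⟩
    · exact ⟨.inr (.inl ()), by simp [h]⟩
    · exact ⟨.inr (.inr (Real.log t)), by simp [Real.exp_log h]⟩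

theorem rat_relIso_sum_sum : Nonempty ((fun a b : ℚ => a < b) ≃r
    Sum.Lex (fun a b : ℚ => a < b) fun a b : ℚ => a < b) := by
  have : Countable (ℚ ⊕ₗ ℚ) := inferInstanceAs (Countable (ℚ ⊕ ℚ))
  obtain ⟨e⟩ := Order.iso_of_countable_dense (ℚ ⊕ₗ ℚ) ℚ
  exact exists_relIso_of_strictMono (sumLex_connected lt_connected lt_connected)
    (e ∘ toLex) (fun a b h => e.lt_iff_lt.2 (Sum.Lex.toLex_lt_toLex.2 h))
    (e.surjective.comp toLex.surjective)

theorem rat_relIso_sum_unit_sum : Nonempty ((fun a b : ℚ => a < b) ≃r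
    Sum.Lex (fun a b : ℚ => a < b) (Sum.Lex (fun _ _ : Unit => False) fun a b : ℚ => a < b)) := by
  have : Countable (ℚ ⊕ₗ Unit ⊕ₗ ℚ) := inferInstanceAs (Countable (ℚ ⊕ Unit ⊕ ℚ))
  obtain ⟨e⟩ := Order.iso_of_countable_dense (ℚ ⊕ₗ Unit ⊕ₗ ℚ) ℚ
  refine exists_relIso_of_strictMono
    (sumLex_connected lt_connected (sumLex_connected (by simp) lt_connected))
    (e ∘ toLex ∘ Sum.map id toLex) (fun a b h => e.lt_iff_lt.2 (Sum.Lex.toLex_lt_toLex.2 ?_))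
    (e.surjective.comp (toLex.surjective.comp
      (Function.surjective_id.sumMap toLex.surjective)))
  rcases h with h | h | _
  · exact .inl h
  · refine .inr (Sum.Lex.toLex_lt_toLex.2 ?_)
    rcases h with h | h | _
    · exact h.elim
    · exact .inr h
    · exact .sep _ _
  · exact .sep _ _

theorem nat_relIso_unit_sum : Nonempty ((fun a b : ℕ => a < b) ≃r
    Sum.Lex (fun _ _ : Unit => False) fun a b : ℕ => a < b) := by
  refine exists_relIso_of_strictMono (sumLex_connected (by simp) lt_connected)
    (Sum.elim (fun _ => 0) Nat.succ) ?_ ?_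
  · rintro _ _ (h | h | _)
    · exact h.elim
    · simpa using h
    · simp
  · rintro (_ | n)
    · exact ⟨.inl (), rfl⟩
    · exact ⟨.inr n, rfl⟩

theorem int_relIso_sum : Nonempty ((fun a b : ℤ => a < b) ≃r
    Sum.Lex (fun a b : ℕ => b < a) fun a b : ℕ => a < b) := by
  refine exists_relIso_of_strictMono
    (sumLex_connected (fun a b => lt_connected b a |>.imp_right (Or.imp_left Eq.symm))
      lt_connected) (Sum.elim Int.negSucc Int.ofNat) ?_ ?_
  · rintro _ _ (h | h | _)
    · simp only [Sum.elim_inl]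
      omega
    · simpa using h
    · simp only [Sum.elim_inl, Sum.elim_inr, Int.ofNat_eq_natCast]
      omega
  · rintro (n | n)
    · exact ⟨.inr n, rfl⟩
    · exact ⟨.inl n, rfl⟩

end Decompositions

/-! ## Covers by the integers -/

section IntegerCovers

variable {W : Type} {F : TFrame W}

theorem TFrame.exists_covers_nat (hg : F.IsGeneral) {A B : Set W} :
    ∀ (D : Finset W) (f : ℕ → W), (∀ d ∈ D, ¬ F.R d d) →
      F.Covers A B (fun a b : ℕ => a < b) f → (∀ d ∈ D, ∀ n, F.clLT d (f n)) →
      ∃ g : ℕ → W, F.Covers (A ∪ D) (B ∪ D) (fun a b : ℕ => a < b) g ∧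
        ∀ n, g n ∈ D ∨ g n ∈ Set.range f := by
  classical
  intro D
  induction D using Finset.strongInduction generalizing A B with
  | H D ih =>
  intro f hirr hf hlt
  rcases D.eq_empty_or_nonempty with rfl | hne
  · exact ⟨f, by simpa using hf, fun n => .inr ⟨n, rfl⟩⟩
  obtain ⟨d, hd, hmax⟩ := hg.finset_max D hne
  have hmax' : ∀ s ∈ D.erase d, F.clLT s d := fun s hs => by
    have hs' := Finset.mem_erase.1 hs
    have hsd := (hmax s hs'.2).resolve_left hs'.1
    exact ⟨hsd, fun h => hirr d hd (hg.trans h hsd)⟩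
  obtain ⟨e⟩ := nat_relIso_unit_sum
  have hc := ((TFrame.covers_unit (hirr d hd)).sum hf fun _ n => hlt d hd n).comp e
  obtain ⟨g, hg1, hg2⟩ := ih (D.erase d) (Finset.erase_ssubset hd) _
    (fun s hs => hirr s (Finset.mem_of_mem_erase hs)) hc (by
      intro s hs n
      simp only [Function.comp]
      rcases e n with a | b
      · exact hmax' s hs
      · exact hlt s (Finset.mem_of_mem_erase hs) b)
  have hsub : ∀ X : Set W, X ∪ D ⊆ ({d} ∪ X) ∪ ↑(D.erase d) := by
    rintro X s (hs | hs)
    · exact .inl (.inr hs)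
    · by_cases h : s = d
      · exact .inl (.inl h)
      · exact .inr (Finset.mem_coe.2 (Finset.mem_erase.2 ⟨h, hs⟩))
  refine ⟨g, hg1.mono (hsub A) (hsub B), fun n => ?_⟩
  rcases hg2 n with h | ⟨m, hm⟩
  · exact .inl (Finset.mem_of_mem_erase h)
  · rw [← hm]
    simp only [Function.comp]
    rcases e m with a | b
    · exact .inl hd
    · exact .inr ⟨b, rfl⟩

theorem TFrame.exists_covers_int (hg : F.IsGeneral) {a z : W} (ha : ∀ y, F.R a y)
    (hz : ∀ y, F.R y z) (A B : Finset W) (hA : ∀ x ∈ A, ¬ F.R x x ∨ ∀ y, F.R y x)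
    (hB : ∀ x ∈ B, ¬ F.R x x ∨ ∀ y, F.R x y) :
    ∃ f : ℤ → W, F.Covers A B (fun a b : ℤ => a < b) f := by
  classical
  by_cases hza : F.R z a
  · have hall : ∀ x y, F.R x y := fun x y => hg.trans (hz x) (hg.trans hza (ha y))
    obtain ⟨f, hf, -⟩ := TFrame.exists_covers_cluster (hasCofinalLabels_lt ℤ)
      (S := insert a (A ∪ B)) ⟨a, by simp⟩ fun x _ y _ => hall x y
    refine ⟨f, hf.mono ?_ ?_⟩ <;>
    · intro s hs
      simp only [Finset.mem_coe] at hs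
      simp [hs]
  set D := (A ∪ B).filter fun x => ¬ F.R x x with hD
  set Z := insert z (A.filter fun x => ∀ y, F.R y x) with hZ
  set I := insert a (B.filter fun x => ∀ y, F.R x y) with hI
  have hDirr : ∀ d ∈ D, ¬ F.R d d := fun d hd => (Finset.mem_filter.1 hd).2
  have hZf : ∀ x ∈ Z, ∀ y, F.R y x := by
    intro x hx
    rcases Finset.mem_insert.1 hx with rfl | hx
    · exact hz
    · exact (Finset.mem_filter.1 hx).2
  have hIi : ∀ x ∈ I, ∀ y, F.R x y := by
    intro x hx
    rcases Finset.mem_insert.1 hx with rfl | hx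
    · exact ha
    · exact (Finset.mem_filter.1 hx).2
  have hID : ∀ x ∈ I, ∀ d ∈ D, F.clLT x d := fun x hx d hd =>
    ⟨hIi x hx d, fun h => hDirr d hd (hg.trans h (hIi x hx d))⟩
  have hDZ : ∀ d ∈ D, ∀ x ∈ Z, F.clLT d x := fun d hd x hx =>
    ⟨hZf x hx d, fun h => hDirr d hd (hg.trans (hZf x hx d) h)⟩
  have hIZ : ∀ x ∈ I, ∀ y ∈ Z, F.clLT x y := fun x hx y hy =>
    ⟨hIi x hx y, fun h => hza (hg.trans (hZf y hy z) (hg.trans h (hIi x hx a)))⟩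
  have hlab : ∀ s n : ℕ, ∃ t, s < t ∧ (Nat.unpair t).1 = n := fun s n =>
    ⟨Nat.pair n (s + 1), Nat.right_le_pair n (s + 1), by simp⟩
  obtain ⟨gZ, hgZ, hgZs⟩ := Finset.exists_nat_enum (S := Z) ⟨z, by simp [hZ]⟩
  obtain ⟨gI, hgI, hgIs⟩ := Finset.exists_nat_enum (S := I) ⟨a, by simp [hI]⟩
  have hcZ : F.Covers Z ∅ (fun a b : ℕ => a < b) fun n => gZ (Nat.unpair n).1 := by
    refine ⟨fun s t _ => hZf _ (hgZ _) _, fun s x hx _ => ?_, fun s x hx => hx.elim,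
      fun x hx => ?_⟩
    · obtain ⟨n, rfl⟩ := hgZs x hx
      obtain ⟨t, ht, rfl⟩ := hlab s n
      exact ⟨t, ht, rfl⟩
    · obtain ⟨n, rfl⟩ := hgZs x (by simpa using hx)
      obtain ⟨t, -, rfl⟩ := hlab 0 n
      exact ⟨t, rfl⟩
  have hcI : F.Covers ∅ I (fun a b : ℕ => b < a) fun n => gI (Nat.unpair n).1 := by
    refine ⟨fun s t _ => hIi _ (hgI _) _, fun s x hx => hx.elim, fun s x hx _ => ?_,
      fun x hx => ?_⟩
    · obtain ⟨n, rfl⟩ := hgIs x hx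
      obtain ⟨t, ht, rfl⟩ := hlab s n
      exact ⟨t, ht, rfl⟩
    · obtain ⟨n, rfl⟩ := hgIs x (by simpa using hx)
      obtain ⟨t, -, rfl⟩ := hlab 0 n
      exact ⟨t, rfl⟩
  obtain ⟨g, hgc, hgr⟩ := TFrame.exists_covers_nat hg D _ hDirr hcZ
    fun d hd n => hDZ d hd _ (hgZ _)
  obtain ⟨e⟩ := int_relIso_sum
  have hc := (hcI.sum hgc (by
    intro s t
    rcases hgr t with h | ⟨m, hm⟩
    · exact hID _ (hgI _) _ h
    · rw [← hm]
      exact hIZ _ (hgI _) _ (hgZ _))).comp e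
  refine ⟨_, hc.mono ?_ ?_⟩
  · intro x hx
    rcases hA x hx with h | h
    · exact .inr (.inr (by simpa [hD, h] using Or.inl hx))
    · exact .inr (.inl (by simpa [hZ, h] using Or.inr hx))
  · intro x hx
    rcases hB x hx with h | h
    · exact .inr (.inr (by simpa [hD, h] using Or.inr hx))
    · exact .inl (by simpa [hI, h] using Or.inr hx)

end IntegerCovers

/-! ## Formulas characterising the frame conditions -/

section Formulas

variable {W : Type} {F : TFrame W}

theorem TFrame.serial_of_valid (hg : F.IsGeneral) (hd : F.Descriptive)
    (hF : F.Valid (.diaF .top)) (hP : F.Valid (.diaP .top)) : F.Serial := by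
  have hu : (Set.univ : Set W) ∈ F.P := hg.2.2.2.2.1
  obtain ⟨x₀⟩ := hg.1
  have hv : ∀ p : ℕ, (fun _ => Set.univ : ℕ → Set W) p ∈ F.P := fun _ => hu
  constructor
  · obtain ⟨m, -, hm⟩ := TFrame.exists_max hg hd hu ⟨x₀, trivial⟩
    obtain ⟨y, hy, -⟩ := hF _ hv m
    have hr : F.R m m := by
      rcases hm y trivial with rfl | h
      exacts [hy, hg.trans hy h]
    refine ⟨m, fun y h => h.2 ?_, hr⟩
    rcases hm y trivial with rfl | h'
    exacts [hr, h']
  · obtain ⟨m, -, hm⟩ := TFrame.exists_min hg hd hu ⟨x₀, trivial⟩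
    obtain ⟨y, hy, -⟩ := hP _ hv m
    have hr : F.R m m := by
      rcases hm y trivial with rfl | h
      exacts [hy, hg.trans h hy]
    refine ⟨m, fun y h => h.2 ?_, hr⟩
    rcases hm y trivial with rfl | h'
    exacts [hr, h']

theorem TFrame.serial_of_lt {T : Type} [Preorder T] [NoMaxOrder T] [NoMinOrder T]
    (hg : F.IsGeneral) (hd : F.Descriptive)
    (h : F.IsFrameFor {φ | (tKripke T (· < ·)).Valid φ}) : F.Serial :=
  TFrame.serial_of_valid hg hd
    (h _ fun _ _ x => (exists_gt x).imp fun _ hy => ⟨hy, trivial⟩)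
    (h _ fun _ _ x => (exists_lt x).imp fun _ hy => ⟨hy, trivial⟩)

theorem TFrame.dense_of_lt {T : Type} [Preorder T] [DenselyOrdered T]
    (hg : F.IsGeneral) (hd : F.Descriptive)
    (h : F.IsFrameFor {φ | (tKripke T (· < ·)).Valid φ}) : F.DenseFrm := by
  have hdense : F.Valid (.neg (.and (.diaF (.var 0)) (.neg (.diaF (.diaF (.var 0)))))) := by
    refine h _ ?_
    rintro v - x ⟨⟨y, hxy, hy⟩, hn⟩
    obtain ⟨z, hxz, hzy⟩ := exists_between (show x < y from hxy)
    exact hn ⟨z, hxz, y, hzy, hy⟩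
  have hbetween : ∀ x y, ¬ F.R y y → F.R x y → ∃ z, F.R x z ∧ F.R z y := by
    intro x y hy hxy
    by_contra! hn
    refine hdense (fun _ => {y}) (fun _ => TFrame.singleton_mem hg hd hy) x
      ⟨⟨y, hxy, rfl⟩, ?_⟩
    rintro ⟨z, hxz, _, hzw, rfl⟩
    exact hn z hxz hzw
  have hg' := hg
  obtain ⟨-, -, -, -, -, hi, -, hF, hP⟩ := hg'
  intro x y hx hy hxy
  by_contra! hcon
  have hI : F.diaP {x} ∩ F.diaF {y} ∈ F.P :=
    hi _ (hP _ (TFrame.singleton_mem hg hd hx)) _ (hF _ (TFrame.singleton_mem hg hd hy))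
  obtain ⟨z₀, hz₀, hz₀'⟩ := hbetween x y hy hxy.1
  obtain ⟨z, ⟨⟨_, rfl, hxz⟩, ⟨_, rfl, hzy⟩⟩, hmin⟩ := TFrame.exists_min hg hd hI
    ⟨z₀, ⟨x, rfl, hz₀⟩, ⟨y, rfl, hz₀'⟩⟩
  have hzz : ¬ F.R z z := fun h => hcon z h ⟨hxz, fun h' => hx (hg.trans hxz h')⟩
    ⟨hzy, fun h' => hy (hg.trans h' hzy)⟩
  obtain ⟨w, hxw, hwz⟩ := hbetween _ z hzz hxz
  rcases hmin w ⟨⟨_, rfl, hxw⟩, ⟨_, rfl, hg.trans hwz hzy⟩⟩ with rfl | h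
  · exact hzz hwz
  · exact hzz (hg.trans h hwz)

/-- A formula refuted when `p` defines a proper initial segment without a last point whose
complement has no first point. -/
def TMF.noGap : TMF :=
  let p : TMF := .var 0
  .neg (.and (.boxP p) (.and p (.and (.diaF p) (.and (.boxF (.imp p (.diaF p)))
    (.and (.boxF (.imp (.neg p) (.diaP (.neg p))))
      (.and (.boxF (.imp (.neg p) (.boxF (.neg p)))) (.diaF (.neg p))))))))

theorem TMF.noGap_sat_iff (M : TModel W) (x : W) : M.sat x TMF.noGap ↔
    ¬ ((∀ y, M.F.R y x → y ∈ M.v 0) ∧ x ∈ M.v 0 ∧ (∃ y, M.F.R x y ∧ y ∈ M.v 0) ∧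
      (∀ y, M.F.R x y → y ∈ M.v 0 → ∃ z, M.F.R y z ∧ z ∈ M.v 0) ∧
      (∀ y, M.F.R x y → y ∉ M.v 0 → ∃ z, M.F.R z y ∧ z ∉ M.v 0) ∧
      (∀ y, M.F.R x y → y ∉ M.v 0 → ∀ z, M.F.R y z → z ∉ M.v 0) ∧
      ∃ y, M.F.R x y ∧ y ∉ M.v 0) := by
  simp only [TMF.noGap, TMF.boxF, TMF.boxP, TMF.imp, TMF.or, TModel.sat]
  grind

theorem noGap_mem_linR : TMF.noGap ∈ LinR := by
  intro v _ x
  rw [TMF.noGap_sat_iff]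
  rintro ⟨h1, h2, ⟨y, hxy, hy⟩, h3, h4, h5, ⟨t, hxt, ht⟩⟩
  simp only [tKripke] at *
  have hbdd : ∀ s ∈ {s | x < s ∧ s ∈ v 0}, s ≤ t := fun s hs => by
    by_contra! hlt
    exact h5 t hxt ht s hlt hs.2
  have hlub := isLUB_csSup (s := {s | x < s ∧ s ∈ v 0}) ⟨y, hxy, hy⟩ ⟨t, hbdd⟩
  set c := sSup {s | x < s ∧ s ∈ v 0}
  have hxc : x < c := hxy.trans_le (hlub.1 ⟨hxy, hy⟩)
  by_cases hc : c ∈ v 0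
  · obtain ⟨z, hcz, hz⟩ := h3 c hxc hc
    exact (hlub.1 ⟨hxc.trans hcz, hz⟩).not_gt hcz
  · obtain ⟨z, hzc, hz⟩ := h4 c hxc hc
    have hxz : x < z := by
      rcases lt_trichotomy x z with h | h | h
      · exact h
      · exact absurd (h ▸ h2) hz
      · exact absurd (h1 z h) hz
    refine (hlub.2 fun s hs => ?_).not_gt hzc
    by_contra! hlt
    exact h5 z hxz hz s hlt hs.2

theorem TFrame.dedekindComplete_of_valid (hg : F.IsGeneral) (hd : F.Descriptive)
    (h : F.Valid TMF.noGap) : F.DedekindComplete := by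
  intro x y hx hy hxy
  by_contra! hcon
  obtain ⟨X, hX, hxX, hyX⟩ : ∃ X ∈ F.P, x ∈ X ∧ y ∉ F.diaF X := by
    by_contra! hcon
    exact hxy.2 ((hd.2.1 y x).2 hcon)
  have hg' := hg
  obtain ⟨-, -, -, -, -, -, hc, hF, -⟩ := hg'
  obtain ⟨D, hD, hdown, hxD, hyD⟩ : ∃ D ∈ F.P, (∀ b ∈ D, ∀ a, F.R a b → a ∈ D) ∧ x ∈ D ∧
      y ∉ D := by
    refine ⟨X ∪ F.diaF X, hg.union_mem hX (hF _ hX), ?_, .inl hxX, ?_⟩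
    · rintro b (hb | ⟨c, hc, hbc⟩) a hab
      · exact .inr ⟨b, hb, hab⟩
      · exact .inr ⟨c, hc, hg.trans hab hbc⟩
    · rintro (h | h)
      · exact hyX ⟨y, h, hy⟩
      · exact hyX h
  have hlt : ∀ a ∈ D, ∀ b ∉ D, F.clLT a b := by
    intro a ha b hb
    have hba : ¬ F.R b a := fun h => hb (hdown a ha b h)
    rcases hg.conn a b with h | rfl | h
    · exact ⟨h, hba⟩
    · exact absurd ha hb
    · exact absurd h hba
  obtain ⟨m, hm, hmax⟩ := TFrame.exists_max hg hd hD ⟨x, hxD⟩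
  obtain ⟨k, hk, hmin⟩ := TFrame.exists_min hg hd (hc _ hD) ⟨y, hyD⟩
  have hmm : F.R m m := by
    by_contra hmm
    rcases hmax x hxD with rfl | hxm
    · exact hmm hx
    · exact hcon m hmm ⟨hxm, fun h => hmm (hg.trans h hxm)⟩ (hlt m hm y hyD)
  have hkk : F.R k k := by
    by_contra hkk
    rcases hmin y hyD with rfl | hky
    · exact hkk hy
    · exact hcon k hkk (hlt x hxD k hk) ⟨hky, fun h => hkk (hg.trans hky h)⟩
  refine (TMF.noGap_sat_iff _ _).1 (h (fun _ => D) (fun _ => hD) x) ⟨fun z hz => hdown x hxD z hz,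
    hxD, ⟨x, hx, hxD⟩, fun z _ hz => ⟨m, ?_, hm⟩, fun z _ hz => ⟨k, ?_, hk⟩,
    fun z _ hz w hzw hw => hz (hdown w hw z hzw), ⟨y, hxy.1, hyD⟩⟩
  · rcases hmax z hz with rfl | h
    exacts [hmm, h]
  · rcases hmin z hz with rfl | h
    exacts [hkk, h]

/-- The Löb formula for `◇_F`. -/
def TMF.loebF : TMF :=
  .neg (.and (.diaF (.var 0)) (.neg (.diaF (.and (.var 0) (.neg (.diaF (.var 0)))))))

/-- The Löb formula for `◇_P`. -/
def TMF.loebP : TMF :=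
  .neg (.and (.diaP (.var 0)) (.neg (.diaP (.and (.var 0) (.neg (.diaP (.var 0)))))))

theorem loebF_mem_linFin : TMF.loebF ∈ LinFin := by
  rintro T _ r - hr v - x ⟨⟨y, hxy, hy⟩, hn⟩
  have : IsTrans T (Function.swap r) := ⟨fun a b c h h' => _root_.trans_of r h' h⟩
  have : Std.Irrefl (Function.swap r) := ⟨fun a h => irrefl_of r a h⟩
  obtain ⟨m, ⟨hxm, hm⟩, hmax⟩ := (Finite.wellFounded_of_trans_of_irrefl (Function.swap r)).has_min
    {z | r x z ∧ z ∈ v 0} ⟨y, hxy, hy⟩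
  refine hn ⟨m, hxm, hm, ?_⟩
  rintro ⟨z, hmz, hz⟩
  exact hmax z ⟨_root_.trans_of r hxm hmz, hz⟩ hmz

theorem loebP_mem_linFin : TMF.loebP ∈ LinFin := by
  rintro T _ r - hr v - x ⟨⟨y, hxy, hy⟩, hn⟩
  obtain ⟨m, ⟨hxm, hm⟩, hmin⟩ := (Finite.wellFounded_of_trans_of_irrefl r).has_min
    {z | r z x ∧ z ∈ v 0} ⟨y, hxy, hy⟩
  refine hn ⟨m, hxm, hm, ?_⟩
  rintro ⟨z, hmz, hz⟩
  exact hmin z ⟨_root_.trans_of r hmz hxm, hz⟩ hmz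

/-- The formula saying that a set of future points that is bounded in the future has a last
element. -/
def TMF.boundedF : TMF :=
  .neg (.and (.diaF (.var 0)) (.and (.diaF (.neg (.diaF (.var 0))))
    (.neg (.diaF (.and (.var 0) (.neg (.diaF (.var 0))))))))

/-- The formula saying that a set of past points that is bounded in the past has a first
element. -/
def TMF.boundedP : TMF :=
  .neg (.and (.diaP (.var 0)) (.and (.diaP (.neg (.diaP (.var 0))))
    (.neg (.diaP (.and (.var 0) (.neg (.diaP (.var 0))))))))

theorem boundedF_mem_linZ : TMF.boundedF ∈ LinZ := by
  rintro v - x ⟨⟨y, hxy, hy⟩, ⟨b, hxb, hb⟩, hn⟩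
  obtain ⟨m, ⟨hxm, hm⟩, hmax⟩ := Int.exists_greatest_of_bdd (P := fun z => x < z ∧ z ∈ v 0)
    ⟨b, fun z hz => by
      by_contra! hlt
      exact hb ⟨z, hlt, hz.2⟩⟩ ⟨y, hxy, hy⟩
  refine hn ⟨m, hxm, hm, ?_⟩
  rintro ⟨z, hmz, hz⟩
  exact (hmax z ⟨hxm.trans hmz, hz⟩).not_gt hmz

theorem boundedP_mem_linZ : TMF.boundedP ∈ LinZ := by
  rintro v - x ⟨⟨y, hxy, hy⟩, ⟨b, hxb, hb⟩, hn⟩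
  obtain ⟨m, ⟨hxm, hm⟩, hmin⟩ := Int.exists_least_of_bdd (P := fun z => z < x ∧ z ∈ v 0)
    ⟨b, fun z hz => by
      by_contra! hlt
      exact hb ⟨z, hlt, hz.2⟩⟩ ⟨y, hxy, hy⟩
  refine hn ⟨m, hxm, hm, ?_⟩
  rintro ⟨z, hmz, hz⟩
  exact (hmin z ⟨lt_trans hmz hxm, hz⟩).not_gt hmz

theorem TFrame.IsGeneral.R_of_not_clLT (hg : F.IsGeneral) {x y : W} (hx : F.R x x)
    (h : ¬ F.clLT x y) : F.R y x := by
  rcases hg.conn x y with h' | rfl | h'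
  · by_contra hn
    exact h ⟨h', hn⟩
  · exact hx
  · exact h'

theorem TFrame.setOf_clLT_notMem_of_loebF (hg : F.IsGeneral) (h : F.Valid TMF.loebF) {x : W}
    (hx : F.R x x) : {z | F.clLT x z} ∉ F.P := by
  intro hmem
  refine h (fun _ => {z | F.clLT x z}ᶜ) (fun _ => hg.2.2.2.2.2.2.1 _ hmem) x
    ⟨⟨x, hx, fun h => h.2 h.1⟩, ?_⟩
  rintro ⟨y, -, hy, hn⟩
  exact hn ⟨x, hg.R_of_not_clLT hx hy, fun h => h.2 h.1⟩

theorem TFrame.setOf_clLT_notMem_of_loebP (hg : F.IsGeneral) (h : F.Valid TMF.loebP) {x : W}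
    (hx : F.R x x) : {z | F.clLT z x} ∉ F.P := by
  intro hmem
  refine h (fun _ => {z | F.clLT z x}ᶜ) (fun _ => hg.2.2.2.2.2.2.1 _ hmem) x
    ⟨⟨x, hx, fun h => h.2 h.1⟩, ?_⟩
  rintro ⟨y, -, hy, hn⟩
  exact hn ⟨x, TFrame.IsGeneral.R_of_not_clLT (F := F.op) hg.op hx hy, fun h => h.2 h.1⟩

theorem TFrame.setOf_clLT_notMem_of_boundedF (hg : F.IsGeneral) (h : F.Valid TMF.boundedF)
    {x : W} (hx : F.R x x) (hne : {z | F.clLT x z}.Nonempty) : {z | F.clLT x z} ∉ F.P := by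
  intro hmem
  obtain ⟨b, hb⟩ := hne
  refine h (fun _ => {z | F.clLT x z}ᶜ) (fun _ => hg.2.2.2.2.2.2.1 _ hmem) x
    ⟨⟨x, hx, fun h => h.2 h.1⟩, ⟨b, hb.1, ?_⟩, ?_⟩
  · rintro ⟨z, hbz, hz⟩
    exact hz ⟨hg.trans hb.1 hbz, fun h => hb.2 (hg.trans hbz h)⟩
  · rintro ⟨y, -, hy, hn⟩
    exact hn ⟨x, hg.R_of_not_clLT hx hy, fun h => h.2 h.1⟩

theorem TFrame.setOf_clLT_notMem_of_boundedP (hg : F.IsGeneral) (h : F.Valid TMF.boundedP)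
    {x : W} (hx : F.R x x) (hne : {z | F.clLT z x}.Nonempty) : {z | F.clLT z x} ∉ F.P := by
  intro hmem
  obtain ⟨b, hb⟩ := hne
  refine h (fun _ => {z | F.clLT z x}ᶜ) (fun _ => hg.2.2.2.2.2.2.1 _ hmem) x
    ⟨⟨x, hx, fun h => h.2 h.1⟩, ⟨b, hb.1, ?_⟩, ?_⟩
  · rintro ⟨z, hbz, hz⟩
    exact hz ⟨hg.trans hbz hb.1, fun h => hb.2 (hg.trans h hbz)⟩
  · rintro ⟨y, -, hy, hn⟩
    exact hn ⟨x, TFrame.IsGeneral.R_of_not_clLT (F := F.op) hg.op hx hy, fun h => h.2 h.1⟩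

end Formulas

/-! ## Frames for the logics of finite orders and of the integers -/

section Discrete

variable {W : Type} {F : TFrame W}

theorem TFrame.isFrameFor_linFin (hg : F.IsGeneral) (hd : F.Descriptive)
    (h : ∀ x : W, F.R x x → ¬ ({z | F.clLT z x} ∈ F.P ∨ {z | F.clLT x z} ∈ F.P)) :
    F.IsFrameFor LinFin := by
  intro φ hφ
  refine TFrame.valid_of_covers hg (Q := fun x => ¬ F.R x x) (Q' := fun x => ¬ F.R x x)
    (fun X hX hne => ?_) (fun X hX hne => ?_) fun A B hne hA hB => ?_
  · obtain ⟨m, hm, hmax⟩ := TFrame.exists_max hg hd hX hne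
    exact ⟨m, hm, fun hr => h m hr (.inr (TFrame.setOf_clLT_max_mem hg hX hm hmax hr)), hmax⟩
  · obtain ⟨m, hm, hmin⟩ := TFrame.exists_min hg hd hX hne
    exact ⟨m, hm, fun hr => h m hr (.inl (TFrame.setOf_clLT_min_mem hg hX hm hmin hr)), hmin⟩
  · let S : Set W := ↑A ∪ ↑B
    have hS : ∀ x : S, ¬ F.R x x := by
      rintro ⟨x, hx | hx⟩
      exacts [hA x hx, hB x hx]
    have hfin : S.Finite := A.finite_toSet.union B.finite_toSet
    obtain ⟨a, ha⟩ := hne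
    refine ⟨S, fun a b => F.R a b, Subtype.val,
      hφ S hfin.fintype _ ⟨⟨a, .inl ha⟩⟩ ?_,
      (TFrame.covers_subtype S).mono Set.subset_union_left Set.subset_union_right⟩
    exact
      { trichotomous := fun a b h1 h2 => by
          rcases hg.conn a b with h | h | h
          · exact absurd h h1
          · exact Subtype.ext h
          · exact absurd h h2
        irrefl := hS
        trans := fun _ _ _ h h' => hg.trans h h' }

theorem TFrame.isFrameFor_linZ (hg : F.IsGeneral) (hd : F.Descriptive) (hs : F.Serial)
    (h : ∀ x : W, F.R x x → ¬ (({z | F.clLT z x}.Nonempty ∧ {z | F.clLT z x} ∈ F.P) ∨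
      ({z | F.clLT x z}.Nonempty ∧ {z | F.clLT x z} ∈ F.P))) :
    F.IsFrameFor LinZ := by
  intro φ hφ
  obtain ⟨z, hz⟩ := hs.exists_final hg
  obtain ⟨a, ha⟩ := hs.exists_initial hg
  refine TFrame.valid_of_covers hg (Q := fun x => ¬ F.R x x ∨ ∀ y, F.R y x)
    (Q' := fun x => ¬ F.R x x ∨ ∀ y, F.R x y)
    (fun X hX hne => ?_) (fun X hX hne => ?_) fun A B hne hA hB => ?_
  · obtain ⟨m, hm, hmax⟩ := TFrame.exists_max hg hd hX hne
    refine ⟨m, hm, ?_, hmax⟩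
    by_contra! hcon
    obtain ⟨hr, y, hy⟩ := hcon
    refine h m hr (.inr ⟨⟨y, ?_⟩, TFrame.setOf_clLT_max_mem hg hX hm hmax hr⟩)
    by_contra hn
    exact hy (hg.R_of_not_clLT hr hn)
  · obtain ⟨m, hm, hmin⟩ := TFrame.exists_min hg hd hX hne
    refine ⟨m, hm, ?_, hmin⟩
    by_contra! hcon
    obtain ⟨hr, y, hy⟩ := hcon
    refine h m hr (.inl ⟨⟨y, ?_⟩, TFrame.setOf_clLT_min_mem hg hX hm hmin hr⟩)
    by_contra hn
    exact hy (TFrame.IsGeneral.R_of_not_clLT (F := F.op) hg.op hr hn)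
  · obtain ⟨f, hf⟩ := TFrame.exists_covers_int hg ha hz A B hA hB
    exact ⟨ℤ, _, f, hφ, hf⟩

end Discrete

/-- characterisation of the finitely generated descriptive temporal frames
for `Lin_Q`, `Lin_R`, `Lin_<ω` and `Lin_Z` (Lemma `l:tempdframes`). -/
theorem temporal_frame_characterisations (W : Type) (F : TFrame W)
    (hg : F.IsGeneral) (hfg : F.FinGenerated) (hd : F.Descriptive) :
    (F.IsFrameFor LinQ ↔ F.Serial ∧ F.DenseFrm) ∧
    (F.IsFrameFor LinR ↔ F.Serial ∧ F.DenseFrm ∧ F.DedekindComplete) ∧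
    (F.IsFrameFor LinFin ↔
      ∀ x : W, F.R x x →
        ¬ ({z | F.clLT z x} ∈ F.P ∨ {z | F.clLT x z} ∈ F.P)) ∧
    (F.IsFrameFor LinZ ↔
      F.Serial ∧ ∀ x : W, F.R x x →
        ¬ (({z | F.clLT z x}.Nonempty ∧ {z | F.clLT z x} ∈ F.P) ∨
           ({z | F.clLT x z}.Nonempty ∧ {z | F.clLT x z} ∈ F.P))) := by
  refine ⟨⟨fun h => ⟨TFrame.serial_of_lt hg hd h, TFrame.dense_of_lt hg hd h⟩, ?_⟩,
    ⟨fun h => ⟨TFrame.serial_of_lt hg hd h, TFrame.dense_of_lt hg hd h,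
      TFrame.dedekindComplete_of_valid hg hd (h _ noGap_mem_linR)⟩, ?_⟩,
    ⟨fun h x hx => ?_, TFrame.isFrameFor_linFin hg hd⟩,
    ⟨fun h => ⟨TFrame.serial_of_lt hg hd h, fun x hx => ?_⟩,
      fun h => TFrame.isFrameFor_linZ hg hd h.1 h.2⟩⟩
  · rintro ⟨hs, hdn⟩ φ hφ
    obtain ⟨e3⟩ := rat_relIso_sum_unit_sum
    exact TFrame.valid_of_dense hg hd hs hdn (hasCofinalLabels_lt ℚ) e3
      (.inl rat_relIso_sum_sum) hφ
  · rintro ⟨hs, hdn, hdc⟩ φ hφ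
    obtain ⟨e3⟩ := real_relIso_sum_unit_sum
    exact TFrame.valid_of_dense hg hd hs hdn (hasCofinalLabels_lt ℝ) e3 (.inr hdc) hφ
  · rintro (hP | hF)
    · exact TFrame.setOf_clLT_notMem_of_loebP hg (h _ loebP_mem_linFin) hx hP
    · exact TFrame.setOf_clLT_notMem_of_loebF hg (h _ loebF_mem_linFin) hx hF
  · rintro (⟨hne, hP⟩ | ⟨hne, hF⟩)
    · exact TFrame.setOf_clLT_notMem_of_boundedP hg (h _ boundedP_mem_linZ) hx hne hP
    · exact TFrame.setOf_clLT_notMem_of_boundedF hg (h _ boundedF_mem_linZ) hx hne hF
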